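/- Let k be a field, A a finite-dimensional self-injective k-algebra, and M a finitely generated self-orthogonal generator for A-mod. If Y is a left A-module such that every homomorphism X → Y from every finitely generated A-module X factors through a module in Add(M), then Y ∈ Add(M). (Claim established in the proof of Lemma 3.13(4): the finitely generated modules form a compact generating set of the M-stable category A-Mod/[M].) -/

import Mathlib

open CategoryTheory
/-! ## Additive closure classes -/

section AddClosure

variable (A : Type) [Ring A]

/-- `X ∈ add M`: `X` is a direct summand of a finite direct sum of copies of `M`. -/
def MemAdd (M X : ModuleCat.{0} A) : Prop :=
  ∃ (n : ℕ) (Y : ModuleCat.{0} A), Nonempty ((↥X × ↥Y) ≃ₗ[A] (Fin n → ↥M))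

/-- `X ∈ Add M`: `X` is a direct summand of an arbitrary direct sum of copies of `M`. -/
def MemAddBig (M X : ModuleCat.{0} A) : Prop :=
  ∃ (I : Type) (Y : ModuleCat.{0} A), Nonempty ((↥X × ↥Y) ≃ₗ[A] (I →₀ ↥M))

/-- a morphism of `A`-modules factors through a projective module -/
def FactorsThroughProj {X Y : ModuleCat.{0} A} (f : X ⟶ Y) : Prop :=
  ∃ (P : ModuleCat.{0} A) (_ : Module.Projective A P) (g : X ⟶ P) (h : P ⟶ Y), f = g ≫ h

/-- a morphism of `A`-modules factors through a module in `Add M` -/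
def FactorsThroughAddM (M : ModuleCat.{0} A) {X Y : ModuleCat.{0} A} (f : X ⟶ Y) : Prop :=
  ∃ (Z : ModuleCat.{0} A) (_ : MemAddBig A M Z) (g : X ⟶ Z) (h : Z ⟶ Y), f = g ≫ h

/-- `X ∈ add M` for unbundled modules. -/
def MemAddPlain (M : Type) [AddCommGroup M] [Module A M]
    (X : Type) [AddCommGroup X] [Module A X] : Prop :=
  ∃ (n : ℕ) (Y : ModuleCat.{0} A), Nonempty ((X × ↥Y) ≃ₗ[A] (Fin n → M))

end AddClosure

/-! ## Ext vanishing -/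

section ExtDefs

variable (A : Type) [Ring A]

/-- vanishing of `Ext^n_A(X, Y)` -/
noncomputable def extZero (n : ℕ) (X Y : ModuleCat.{0} A) : Prop :=
  Subsingleton (((Ext ℤ (ModuleCat.{0} A) n).obj (Opposite.op X)).obj Y)

/-- `M` is self-orthogonal: `Ext^n_A(M,M) = 0` for all `n ≥ 1`. -/
noncomputable def SelfOrthogonal (M : ModuleCat.{0} A) : Prop :=
  ∀ n : ℕ, 1 ≤ n → extZero A n M M

/-- `M` is a generator for `A`-mod: `A ∈ add M`. -/
def IsGen (M : ModuleCat.{0} A) : Prop :=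
  MemAdd A M (ModuleCat.of A A)

/-- membership in the `M`-Gorenstein subcategory `𝒢`:
`Ext^n_A(M,X) = 0 = Ext^n_A(X,M)` for all `n ≥ 1`. -/
noncomputable def MemG (M X : ModuleCat.{0} A) : Prop :=
  ∀ n : ℕ, 1 ≤ n → extZero A n M X ∧ extZero A n X M

end ExtDefs


theorem aux_map_jac {R P Q : Type} [Ring R] [AddCommGroup P] [Module R P] [AddCommGroup Q]
    [Module R Q] (J : Ideal R) (f : P →ₗ[R] Q) :
    (J • ⊤ : Submodule R P) ≤ (J • ⊤ : Submodule R Q).comap f := by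
  intro x hx
  refine Submodule.smul_induction_on hx ?_ ?_
  · intro r hr n _
    simp only [Submodule.mem_comap, map_smul]
    exact Submodule.smul_mem_smul hr trivial
  · intro x y hx hy
    exact Submodule.add_mem _ hx hy

theorem aux_nak {R P : Type} [Ring R] [AddCommGroup P] [Module R P] (J : Ideal R)
    (hJ : IsNilpotent J) (K : Submodule R P) (h : K ≤ J • K) : K = ⊥ := by
  obtain ⟨n, hn⟩ := hJ
  have : ∀ n, K ≤ J ^ n • K := by
    intro n
    induction n with
    | zero => rw [J.pow_zero, Submodule.one_smul]
    | succ n ih =>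
      rw [J.pow_succ, Submodule.mul_smul]
      exact ih.trans (Submodule.smul_mono le_rfl h)
  have h2 := this n
  rw [hn] at h2
  simpa using h2

theorem aux_nak_top {R P : Type} [Ring R] [AddCommGroup P] [Module R P] (J : Ideal R)
    (hJ : IsNilpotent J) (N : Submodule R P) (h : ∀ x : P, ∃ y ∈ N, x - y ∈ (J • ⊤ : Submodule R P)) :
    N = ⊤ := by
  have h1 : (⊤ : Submodule R (P ⧸ N)) = ⊥ := by
    apply aux_nak J hJ
    rintro x -
    obtain ⟨x, rfl⟩ := N.mkQ_surjective x
    obtain ⟨y, hy, hxy⟩ := h x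
    have h2 := aux_map_jac J N.mkQ hxy
    have h3 : N.mkQ y = 0 := by simpa using hy
    simpa [h3, map_sub] using h2
  rw [eq_top_iff]
  rintro x -
  have : N.mkQ x ∈ (⊥ : Submodule R (P ⧸ N)) := h1 ▸ trivial
  simpa using this

theorem aux_ss (R F : Type) [Ring R] [AddCommGroup F] [Module R F] [IsSemiprimaryRing R] :
    IsSemisimpleModule R (F ⧸ (Ring.jacobson R • ⊤ : Submodule R F)) := by
  have hM : Module.IsTorsionBySet R (F ⧸ (Ring.jacobson R • ⊤ : Submodule R F))
      (Ring.jacobson R) := by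
    rw [Module.isTorsionBySet_quotient_iff]
    exact fun m i hi ↦ Submodule.smul_mem_smul hi trivial
  let _ := hM.module
  exact hM.isSemisimpleModule_iff.1 inferInstance

theorem aux_coord {R ι : Type} [Ring R] (J : Ideal R) [J.IsTwoSided] (x : ι →₀ R)
    (hx : x ∈ (J • ⊤ : Submodule R (ι →₀ R))) (i : ι) : x i ∈ J := by
  refine Submodule.smul_induction_on hx ?_ ?_
  · intro r hr n _
    simpa using J.mul_mem_right _ hr
  · intro x y hx hy
    simpa using J.add_mem hx hy

noncomputable def auxEndQ {R P : Type} [Ring R] [AddCommGroup P] [Module R P] (J : Ideal R) :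
    Module.End R P →+* Module.End R (P ⧸ (J • ⊤ : Submodule R P)) where
  toFun f := Submodule.mapQ _ _ f (aux_map_jac J f)
  map_one' := by ext; rfl
  map_zero' := by ext; rfl
  map_mul' f g := by ext; rfl
  map_add' f g := by ext; rfl

theorem aux_lift {R P : Type} [Ring R] [AddCommGroup P] [Module R P] [Module.Projective R P]
    (J : Ideal R) (hJ : IsNilpotent J) (b : Module.End R (P ⧸ (J • ⊤ : Submodule R P)))
    (hb : IsIdempotentElem b) : ∃ e : Module.End R P, IsIdempotentElem e ∧
      ∀ x, Submodule.Quotient.mk (e x) = b (Submodule.Quotient.mk x) := by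
  have hr : b ∈ (auxEndQ (P := P) J).range := by
    obtain ⟨g, hg⟩ := Module.projective_lifting_property (Submodule.mkQ (J • ⊤ : Submodule R P))
      (b ∘ₗ Submodule.mkQ _) (Submodule.mkQ_surjective _)
    refine ⟨g, ?_⟩
    ext x
    exact LinearMap.congr_fun hg x
  have hk : ∀ x ∈ RingHom.ker (auxEndQ (P := P) J), IsNilpotent x := by
    intro f hf
    obtain ⟨n, hn⟩ := hJ
    refine ⟨n, ?_⟩
    have h0 : ∀ x, f x ∈ (J • ⊤ : Submodule R P) := by
      intro x
      have := LinearMap.congr_fun (show auxEndQ (P := P) J f = 0 from hf) (Submodule.Quotient.mk x)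
      exact (Submodule.Quotient.mk_eq_zero _).1 this
    have h1 : ∀ n, ∀ x, (f ^ n) x ∈ (J ^ n • ⊤ : Submodule R P) := by
      intro n
      induction n with
      | zero => intro x; rw [J.pow_zero, Submodule.one_smul]; trivial
      | succ n ih =>
        intro x
        rw [pow_succ', J.pow_succ, Submodule.mul_smul, Module.End.mul_apply]
        refine Submodule.smul_induction_on (p := fun y => f y ∈ J ^ n • J • (⊤ : Submodule R P))
          (ih x) ?_ ?_
        · intro r hr m _
          rw [map_smul]
          exact Submodule.smul_mem_smul hr (h0 m)
        · intro y z hy hz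
          rw [map_add]
          exact Submodule.add_mem _ hy hz
    ext x
    have := h1 n x
    rw [hn] at this
    simpa using this
  obtain ⟨e, he, hee⟩ := exists_isIdempotentElem_eq_of_ker_isNilpotent _ hk b hr hb
  exact ⟨e, he, fun x => LinearMap.congr_fun hee (Submodule.Quotient.mk x)⟩

theorem aux_flat {R F : Type} [Ring R] [AddCommGroup F] [Module R F] [IsSemiprimaryRing R]
    (hflat : ∀ (ι : Type) [Fintype ι] (x : ι → R) (f : ι → F), ∑ i, x i • f i = 0 →
      ∃ (κ : Type) (_ : Fintype κ) (u : ι → κ → R) (v : κ → F),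
        (∀ i, f i = ∑ j, u i j • v j) ∧ ∀ j, ∑ i, x i * u i j = 0) :
    Module.Projective R F := by
  have hJ : IsNilpotent (Ring.jacobson R) := IsSemiprimaryRing.isNilpotent
  set J := Ring.jacobson R with hJdef
  have ss1 : IsSemisimpleModule R (F ⧸ (J • ⊤ : Submodule R F)) := aux_ss R F
  have ss2 : IsSemisimpleModule R ((F →₀ R) ⧸ (J • ⊤ : Submodule R (F →₀ R))) := aux_ss R _
  let p : (F →₀ R) →ₗ[R] F := Finsupp.linearCombination R id
  have hp : Function.Surjective p := fun y => ⟨Finsupp.single y 1, by simp [p]⟩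
  let pb := Submodule.mapQ _ _ p (aux_map_jac J p)
  have hpb : Function.Surjective pb := by
    intro y
    obtain ⟨y, rfl⟩ := Submodule.mkQ_surjective _ y
    obtain ⟨x, rfl⟩ := hp y
    exact ⟨Submodule.Quotient.mk x, rfl⟩
  obtain ⟨s, hs⟩ := IsSemisimpleModule.lifting_property pb hpb LinearMap.id
  have hs' : ∀ y, pb (s y) = y := fun y => LinearMap.congr_fun hs y
  obtain ⟨e, he, hee⟩ := aux_lift J hJ (s ∘ₗ pb) (by
    ext x
    simp [hs'])
  have he' : ∀ x, e (e x) = e x := fun x => LinearMap.congr_fun he x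
  let q : (F →₀ R) →ₗ[R] F := p ∘ₗ e
  have hq : Function.Surjective q := by
    rw [← LinearMap.range_eq_top]
    apply aux_nak_top J hJ
    intro y
    obtain ⟨x, rfl⟩ := hp y
    refine ⟨q x, ⟨x, rfl⟩, ?_⟩
    rw [← Submodule.Quotient.mk_eq_zero, Submodule.Quotient.mk_sub, sub_eq_zero]
    have h1 := congrArg pb (hee x)
    simp only [LinearMap.comp_apply, hs'] at h1
    exact h1.symm
  let K : Submodule R (F →₀ R) := LinearMap.ker p ⊓ LinearMap.ker (e - 1)
  have hKmem : ∀ x, x ∈ K ↔ p x = 0 ∧ e x = x := by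
    intro x
    simp [K, sub_eq_zero]
  have hK : K = ⊥ := by
    apply aux_nak J hJ
    intro x hx
    obtain ⟨hx1, hx2⟩ := (hKmem x).1 hx
    have hxJ : x ∈ (J • ⊤ : Submodule R (F →₀ R)) := by
      rw [← Submodule.Quotient.mk_eq_zero]
      have h1 := hee x
      rw [hx2] at h1
      rw [h1]
      have h2 : pb (Submodule.Quotient.mk x) = 0 := by
        change Submodule.Quotient.mk (p x) = _
        rw [hx1]; rfl
      simp [h2]
    have hsum : x = ∑ i : x.support, x i • Finsupp.single (i : F) (1 : R) := by
      conv_lhs => rw [← Finsupp.sum_single x]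
      rw [Finsupp.sum, ← Finset.sum_coe_sort]
      simp
    have hex : x = ∑ i : x.support, x i • e (Finsupp.single (i : F) (1 : R)) := by
      conv_lhs => rw [← hx2, hsum]
      simp only [map_sum, map_smul]
    obtain ⟨κ, _, u, v, h1, h2⟩ := hflat x.support (fun i => x i)
      (fun i => q (Finsupp.single (i : F) (1 : R))) (by
        have h3 := congrArg p hex
        rw [hx1, map_sum] at h3
        simpa only [map_smul, q, LinearMap.comp_apply] using h3.symm)
    choose w hw using fun j => hq (v j)
    have hx3 : x = ∑ i : x.support, x i •
        (e (Finsupp.single (i : F) (1 : R)) - ∑ j, u i j • e (w j)) := by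
      simp only [smul_sub, Finset.sum_sub_distrib, Finset.smul_sum, ← mul_smul]
      rw [Finset.sum_comm]
      simp only [← Finset.sum_smul, h2]
      simpa using hex
    rw [hx3]
    refine Submodule.sum_mem _ fun i _ => Submodule.smul_mem_smul (aux_coord J x hxJ i) ?_
    rw [hKmem]
    constructor
    · have h4 : ∀ j, p (e (w j)) = v j := hw
      have h5 := h1 i
      simp only [map_sub, map_sum, map_smul, h4, ← h5]
      exact sub_self _
    · simp only [map_sub, map_sum, map_smul, he']
  have hker : ∀ x, q x = 0 → e x = 0 := by
    intro x hx
    have : e x ∈ K := (hKmem _).2 ⟨hx, he' x⟩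
    rw [hK] at this
    simpa using this
  choose t ht using hq
  have hqe : ∀ x, q (e x) = q x := fun x => by simp [q, he']
  have key : ∀ x y, q x = q y → e x = e y := by
    intro x y hxy
    have := hker (x - y) (by rw [map_sub, hxy, sub_self])
    rwa [map_sub, sub_eq_zero] at this
  let σ : F →ₗ[R] (F →₀ R) :=
    { toFun := fun y => e (t y)
      map_add' := fun a b => by
        rw [← map_add]
        exact key _ _ (by rw [map_add, ht, ht, ht])
      map_smul' := fun r a => by
        rw [← map_smul]
        exact key _ _ (by rw [map_smul, ht, ht]; rfl) }
  exact Module.Projective.of_split σ q (by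
    ext y
    simp [σ, hqe, ht])

theorem aux_art (k A M : Type) [Field k] [Ring A] [Algebra k A] [FiniteDimensional k A]
    [AddCommGroup M] [Module A M] [Module.Finite A M] :
    IsArtinianRing (Module.End A M)ᵐᵒᵖ := by
  letI : Module k M := Module.compHom M (algebraMap k A)
  haveI : IsScalarTower k A M := ⟨fun x y z => by
    rw [Algebra.smul_def, mul_smul]; rfl⟩
  haveI : Module.Finite k M := Module.Finite.trans A M
  haveI : Module.Finite k (Module.End A M) :=
    Module.Finite.of_injective (LinearMap.restrictScalarsₗ k A M M k)
      (LinearMap.restrictScalars_injective k)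
  exact IsArtinianRing.of_finite k _

theorem aux_supp {A N M I : Type} [Ring A] [AddCommGroup M] [Module A M] [AddCommGroup N]
    [Module A N] [Module.Finite A N] (g : N →ₗ[A] (I →₀ M)) :
    ∃ T : Finset I, ∀ n, (g n).support ⊆ T := by
  classical
  obtain ⟨S, hS⟩ := (Module.Finite.fg_top : (⊤ : Submodule A N).FG)
  refine ⟨S.biUnion fun s => (g s).support, fun n => ?_⟩
  have hn : n ∈ Submodule.span A (S : Set N) := hS ▸ trivial
  induction hn using Submodule.span_induction with
  | mem x hx => exact Finset.subset_biUnion_of_mem (fun s => (g s).support) hx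
  | zero => simp
  | add x y _ _ hx hy =>
    rw [map_add]
    exact Finsupp.support_add.trans (Finset.union_subset hx hy)
  | smul a x _ hx =>
    rw [map_smul]
    exact Finsupp.support_smul.trans hx

theorem aux_crit {A : Type} [Ring A] (M : ModuleCat.{0} A) [Module.Finite A ↥M]
    (Y : ModuleCat.{0} A)
    (h : ∀ X : ModuleCat.{0} A, Module.Finite A ↥X →
      ∀ f : X ⟶ Y, FactorsThroughAddM A M f)
    (ι : Type) [Fintype ι] (x : ι → (Module.End A M)ᵈᵐᵃ) (f : ι → (M →ₗ[A] Y))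
    (hx : ∑ i, x i • f i = 0) :
      ∃ (κ : Type) (_ : Fintype κ) (u : ι → κ → (Module.End A M)ᵈᵐᵃ) (v : κ → (M →ₗ[A] Y)),
        (∀ i, f i = ∑ j, u i j • v j) ∧ ∀ j, ∑ i, x i * u i j = 0 := by
  classical
  let xh : M →ₗ[A] (ι → M) := LinearMap.pi fun i => DomMulAct.mk.symm (x i)
  let fh : (ι → M) →ₗ[A] Y := ∑ i, f i ∘ₗ LinearMap.proj i
  have hfx : LinearMap.range xh ≤ LinearMap.ker fh := by
    rintro _ ⟨m, rfl⟩
    have h1 := LinearMap.congr_fun hx m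
    simpa [fh, xh, LinearMap.sum_apply, DomMulAct.smul_linearMap_apply] using h1
  obtain ⟨Z, ⟨I, W, ⟨φ⟩⟩, g, hh, hgh⟩ := h (ModuleCat.of A ((ι → M) ⧸ LinearMap.range xh))
    (inferInstanceAs (Module.Finite A ((ι → M) ⧸ LinearMap.range xh)))
    (ModuleCat.ofHom (Submodule.liftQ _ fh hfx))
  let g' : (ι → M) →ₗ[A] (I →₀ M) :=
    φ.toLinearMap ∘ₗ LinearMap.inl A Z W ∘ₗ g.hom ∘ₗ Submodule.mkQ _
  let h' : (I →₀ M) →ₗ[A] Y := hh.hom ∘ₗ LinearMap.fst A Z W ∘ₗ φ.symm.toLinearMap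
  have hg' : ∀ m, h' (g' m) = fh m := by
    intro m
    have h1 := LinearMap.congr_fun (congrArg ModuleCat.Hom.hom hgh) (Submodule.Quotient.mk m)
    have h2 : fh m = hh.hom (g.hom (Submodule.Quotient.mk m)) := h1
    simp [h', g', h2]
  have hgx : ∀ m, g' (xh m) = 0 := by
    intro m
    have : (Submodule.mkQ (LinearMap.range xh)) (xh m) = 0 := by simp
    simp only [g', LinearMap.comp_apply, this, map_zero]
  obtain ⟨T, hT⟩ := aux_supp g'
  refine ⟨T, inferInstance, fun i j => DomMulAct.mk
    (Finsupp.lapply (R := A) (j : I) ∘ₗ g' ∘ₗ LinearMap.single A (fun _ => (M : Type)) i),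
    fun j => h' ∘ₗ Finsupp.lsingle (j : I), ?_, ?_⟩
  · intro i
    ext m
    have h1 : f i m = fh (Pi.single i m) := by
      simp only [fh, LinearMap.sum_apply, LinearMap.comp_apply, LinearMap.proj_apply]
      rw [Finset.sum_eq_single i]
      · simp
      · intro b _ hb
        simp [Pi.single_eq_of_ne hb]
      · simp
    rw [h1, ← hg']
    have h2 : g' (Pi.single i m) = ∑ j : T, Finsupp.single (j : I) (g' (Pi.single i m) j) := by
      conv_lhs => rw [← Finsupp.sum_single (g' (Pi.single i m))]
      rw [Finsupp.sum_of_support_subset _ (hT _) _ (by simp), ← Finset.sum_coe_sort]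
    conv_lhs => rw [h2]
    rw [map_sum, LinearMap.sum_apply]
    rfl
  · intro j
    apply DomMulAct.mk.symm.injective
    have h3 : ∀ m : M, ∑ i, g' (Pi.single i (xh m i)) (j : I) = 0 := by
      intro m
      rw [← Finsupp.finset_sum_apply, ← map_sum, Finset.univ_sum_single, hgx]
      rfl
    have h4 : ∀ (s : Finset ι) (c : ι → (Module.End A M)ᵈᵐᵃ),
        DomMulAct.mk.symm (∑ i ∈ s, c i) = ∑ i ∈ s, DomMulAct.mk.symm (c i) := by
      intro s c
      induction s using Finset.induction_on with
      | empty => rfl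
      | insert a s ha ih => rw [Finset.sum_insert ha, Finset.sum_insert ha, ← ih]; rfl
    rw [h4]
    apply LinearMap.ext
    intro m
    rw [LinearMap.sum_apply]
    exact h3 m

theorem aux_gen {A : Type} [Ring A] (M : ModuleCat.{0} A) (hgen : IsGen A M) :
    ∃ (n : ℕ) (m : Fin n → M) (φ : Fin n → (M →ₗ[A] A)), ∑ i, φ i (m i) = 1 := by
  obtain ⟨n, W, ⟨ψ⟩⟩ := hgen
  let ψ' : (A × W) ≃ₗ[A] (Fin n → M) := ψ
  refine ⟨n, ψ' (1, 0), fun i => LinearMap.fst A A W ∘ₗ ψ'.symm.toLinearMap ∘ₗ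
    LinearMap.single A (fun _ => (M : Type)) i, ?_⟩
  have h1 : ∑ i, Pi.single i (ψ' (1, 0) i) = ψ' (1, 0) := Finset.univ_sum_single _
  have h2 := congrArg (fun z => (ψ'.symm z).1) h1
  simpa [Prod.fst_sum] using h2

/-- evaluation -/
noncomputable def auxEv {A M F : Type} [Ring A] [AddCommGroup M] [Module A M]
    (c : F →₀ (Module.End A M)ᵈᵐᵃ) : M →ₗ[A] (F →₀ M) where
  toFun m := c.mapRange (fun r => (DomMulAct.mk.symm r : Module.End A M) m) rfl
  map_add' a b := by
    ext i
    exact map_add (DomMulAct.mk.symm (c i) : Module.End A M) a b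
  map_smul' a b := by
    ext i
    exact map_smul (DomMulAct.mk.symm (c i) : Module.End A M) a b

theorem aux_split {A M Y : Type} [Ring A] [AddCommGroup M] [Module A M] [AddCommGroup Y]
    [Module A Y] (n : ℕ) (m : Fin n → M) (φ : Fin n → (M →ₗ[A] A)) (hm : ∑ i, φ i (m i) = 1)
    (hproj : Module.Projective (Module.End A M)ᵈᵐᵃ (M →ₗ[A] Y)) :
    ∃ (p : ((M →ₗ[A] Y) →₀ M) →ₗ[A] Y) (σ : Y →ₗ[A] ((M →ₗ[A] Y) →₀ M)),
      ∀ y, p (σ y) = y := by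
  obtain ⟨s, hs⟩ := hproj.out
  let p : ((M →ₗ[A] Y) →₀ M) →ₗ[A] Y := Finsupp.lsum ℕ fun f => f
  have hadd : ∀ (c d : (M →ₗ[A] Y) →₀ (Module.End A M)ᵈᵐᵃ) (x : M),
      auxEv (c + d) x = auxEv c x + auxEv d x := by
    intro c d x; ext f; rfl
  have hzero : ∀ x : M, auxEv (0 : (M →ₗ[A] Y) →₀ (Module.End A M)ᵈᵐᵃ) x = 0 := by
    intro x; ext f; rfl
  have hsum : ∀ {ι : Type} (t : Finset ι) (c : ι → ((M →ₗ[A] Y) →₀ (Module.End A M)ᵈᵐᵃ)) (x : M),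
      auxEv (∑ i ∈ t, c i) x = ∑ i ∈ t, auxEv (c i) x := by
    classical
    intro ι t c x
    induction t using Finset.induction_on with
    | empty => simp [hzero]
    | insert a t ha ih => rw [Finset.sum_insert ha, Finset.sum_insert ha, hadd, ih]
  have hsmul : ∀ (r : Module.End A M) (c : (M →ₗ[A] Y) →₀ (Module.End A M)ᵈᵐᵃ) (x : M),
      auxEv (DomMulAct.mk r • c) x = auxEv c (r x) := by
    intro r c x; ext f; rfl
  have hp : ∀ (c : (M →ₗ[A] Y) →₀ (Module.End A M)ᵈᵐᵃ) (x : M),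
      p (auxEv c x) = Finsupp.linearCombination (Module.End A M)ᵈᵐᵃ id c x := by
    intro c x
    induction c using Finsupp.induction_linear with
    | zero => rw [hzero]; simp
    | add c d hc hd => rw [hadd, map_add, map_add, hc, hd]; rfl
    | single f r =>
      have : auxEv (Finsupp.single f r) x =
          Finsupp.single f ((DomMulAct.mk.symm r : Module.End A M) x) :=
        Finsupp.mapRange_single (hf := rfl)
      rw [this]
      simp [p, DomMulAct.smul_linearMap_apply]
  have hps : ∀ f x, p (auxEv (s f) x) = f x := by
    intro f x
    rw [hp, hs f]
  let G : Y → Fin n → (M →ₗ[A] Y) := fun y i => LinearMap.toSpanSingleton A Y y ∘ₗ φ i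
  have hG : ∀ y i x, G y i x = φ i x • y := fun _ _ _ => rfl
  let σ : Y →ₗ[A] ((M →ₗ[A] Y) →₀ M) :=
    { toFun := fun y => ∑ i, auxEv (s (G y i)) (m i)
      map_add' := fun y z => by
        rw [← Finset.sum_add_distrib]
        refine Finset.sum_congr rfl fun i _ => ?_
        rw [← hadd, ← map_add]
        have h1 : G (y + z) i = G y i + G z i := by
          ext x
          rw [LinearMap.add_apply, hG, hG, hG, smul_add]
        rw [h1]
      map_smul' := fun a y => by
        let E : Fin n → Fin n → Module.End A M := fun i j =>
          LinearMap.toSpanSingleton A M (a • m j) ∘ₗ φ i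
        have hE : ∀ i j x, E i j x = φ i x • a • m j := fun _ _ _ => rfl
        have h1 : ∀ i, G (a • y) i = ∑ j, DomMulAct.mk (E i j) • G y j := by
          intro i
          ext x
          rw [LinearMap.sum_apply, hG]
          have : ∀ j, (DomMulAct.mk (E i j) • G y j) x = (φ i x * a * φ j (m j)) • y := by
            intro j
            change G y j (E i j x) = _
            rw [hG, hE, map_smul, map_smul, smul_eq_mul, smul_eq_mul, mul_assoc]
          simp only [this]
          rw [← Finset.sum_smul, ← Finset.mul_sum, hm, mul_one, mul_smul]
        simp only [h1, map_sum, map_smul, hsum, hsmul, RingHom.id_apply]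
        rw [Finset.sum_comm, Finset.smul_sum]
        refine Finset.sum_congr rfl fun j _ => ?_
        rw [← map_sum]
        simp only [hE, ← Finset.sum_smul, hm, one_smul, map_smul] }
  refine ⟨p, σ, fun y => ?_⟩
  change p (∑ i, auxEv (s (G y i)) (m i)) = y
  simp only [map_sum, hps, hG, ← Finset.sum_smul, hm, one_smul]

/-- If every homomorphism to `Y` from a finitely generated module factors through `Add M`,
then `Y ∈ Add M`. -/
theorem mem_AddM_of_all_fg_maps_factor
    (k A : Type) [Field k] [Ring A] [Algebra k A] [FiniteDimensional k A]
    [Module.Injective A A]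
    (M : ModuleCat.{0} A) [Module.Finite A ↥M]
    (hgen : IsGen A M) (hso : SelfOrthogonal A M)
    (Y : ModuleCat.{0} A)
    (h : ∀ X : ModuleCat.{0} A, Module.Finite A ↥X →
      ∀ f : X ⟶ Y, FactorsThroughAddM A M f) :
    MemAddBig A M Y := by
  obtain ⟨n, m, φ, hm⟩ := aux_gen M hgen
  haveI : IsArtinianRing (Module.End A M)ᵈᵐᵃ := aux_art k A M
  have hproj : Module.Projective (Module.End A M)ᵈᵐᵃ (M →ₗ[A] Y) :=
    aux_flat fun ι _ x f hx => aux_crit M Y h ι x f hx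
  obtain ⟨p, σ, hσ⟩ := aux_split n m φ hm hproj
  refine ⟨(M →ₗ[A] Y), ModuleCat.of A (LinearMap.ker p), ⟨?_⟩⟩
  have hex : Function.Exact (LinearMap.ker p).subtype p := LinearMap.exact_subtype_ker_map p
  exact (LinearEquiv.prodComm A _ _).trans
    (hex.splitSurjectiveEquiv (Submodule.subtype_injective _) ⟨σ, LinearMap.ext hσ⟩).1.symm
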